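/- Let R be an associative ring with unit and let (A, B) be a hereditary complete cotorsion pair in Mod R with kernel ω = A ∩ B. Then pd(A) = pd_A(A) = coresdim_B(A) = coresdim_ω(A) = coresdim_B(Mod R), where all quantities may be infinite. -/

import Mathlib

noncomputable section

open CategoryTheory CategoryTheory.Limits Opposite DirectSum

universe u

namespace CotorsionDim

variable {R : Type u} [Ring R]

/-- `Ext^n_R(M,N) = 0`. -/
def ExtZero (M N : ModuleCat.{u} R) (n : ℕ) : Prop :=
  IsZero (((Ext ℤ (ModuleCat.{u} R) n).obj (op M)).obj N)

/-- A pair of composable maps forms a short exact sequence `0 → A → B → C → 0`. -/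
def IsSES {A B C : ModuleCat.{u} R} (f : A ⟶ B) (g : B ⟶ C) : Prop :=
  ∃ w : f ≫ g = 0, (CategoryTheory.ShortComplex.mk f g w).ShortExact

/-- relative projective dimension `pd_𝒳(M)` -/
def rpd (𝒳 : Set (ModuleCat.{u} R)) (M : ModuleCat.{u} R) : ℕ∞ :=
  sInf {n : ℕ∞ | ∀ j : ℕ, n < (j : ℕ∞) → ∀ X ∈ 𝒳, ExtZero M X j}

/-- relative injective dimension `id_𝒳(M)` -/
def rid (𝒳 : Set (ModuleCat.{u} R)) (M : ModuleCat.{u} R) : ℕ∞ :=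
  sInf {n : ℕ∞ | ∀ j : ℕ, n < (j : ℕ∞) → ∀ X ∈ 𝒳, ExtZero X M j}

/-- `pd_𝒳(𝒴)` -/
def rpdClass (𝒳 𝒴 : Set (ModuleCat.{u} R)) : ℕ∞ := ⨆ Y : 𝒴, rpd 𝒳 Y

/-- `id_𝒳(𝒴)` -/
def ridClass (𝒳 𝒴 : Set (ModuleCat.{u} R)) : ℕ∞ := ⨆ Y : 𝒴, rid 𝒳 Y

/-- projective dimension -/
def pd (M : ModuleCat.{u} R) : ℕ∞ := rpd Set.univ M

/-- injective dimension -/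
def idim (M : ModuleCat.{u} R) : ℕ∞ := rid Set.univ M

/-- `pd(𝒴)` -/
def pdClass (𝒴 : Set (ModuleCat.{u} R)) : ℕ∞ := ⨆ Y : 𝒴, pd Y.1

/-- `id(𝒴)` -/
def idClass (𝒴 : Set (ModuleCat.{u} R)) : ℕ∞ := ⨆ Y : 𝒴, idim Y.1

/-- `M` has an `𝒳`-resolution `0 → X_n → ⋯ → X_0 → M → 0` of length `n`. -/
def HasResLen (𝒳 : Set (ModuleCat.{u} R)) : ℕ → ModuleCat.{u} R → Prop
  | 0, M => M ∈ 𝒳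
  | n+1, M => ∃ (K X : ModuleCat.{u} R) (f : K ⟶ X) (g : X ⟶ M),
      X ∈ 𝒳 ∧ IsSES f g ∧ HasResLen 𝒳 n K

/-- `M` has an `𝒳`-coresolution `0 → M → X_0 → ⋯ → X_n → 0` of length `n`. -/
def HasCoresLen (𝒳 : Set (ModuleCat.{u} R)) : ℕ → ModuleCat.{u} R → Prop
  | 0, M => M ∈ 𝒳
  | n+1, M => ∃ (X C : ModuleCat.{u} R) (f : M ⟶ X) (g : X ⟶ C),
      X ∈ 𝒳 ∧ IsSES f g ∧ HasCoresLen 𝒳 n C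

/-- `resdim_𝒳(M)` -/
def resdim (𝒳 : Set (ModuleCat.{u} R)) (M : ModuleCat.{u} R) : ℕ∞ :=
  ⨅ n : {n : ℕ // HasResLen 𝒳 n M}, (n : ℕ∞)

/-- `coresdim_𝒳(M)` -/
def coresdim (𝒳 : Set (ModuleCat.{u} R)) (M : ModuleCat.{u} R) : ℕ∞ :=
  ⨅ n : {n : ℕ // HasCoresLen 𝒳 n M}, (n : ℕ∞)

/-- `resdim_𝒳(𝒴)` -/
def resdimClass (𝒳 𝒴 : Set (ModuleCat.{u} R)) : ℕ∞ := ⨆ Y : 𝒴, resdim 𝒳 Y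

/-- `coresdim_𝒳(𝒴)` -/
def coresdimClass (𝒳 𝒴 : Set (ModuleCat.{u} R)) : ℕ∞ := ⨆ Y : 𝒴, coresdim 𝒳 Y

/-- `𝒳^∧`, the class of modules with a finite `𝒳`-resolution. -/
def resClosure (𝒳 : Set (ModuleCat.{u} R)) : Set (ModuleCat.{u} R) :=
  {M | ∃ n, HasResLen 𝒳 n M}

/-- `𝒳^∨`, the class of modules with a finite `𝒳`-coresolution. -/
def coresClosure (𝒳 : Set (ModuleCat.{u} R)) : Set (ModuleCat.{u} R) :=
  {M | ∃ n, HasCoresLen 𝒳 n M}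

/-- `(𝒜, ℬ)` is a cotorsion pair. -/
def IsCotorsionPair (𝒜 ℬ : Set (ModuleCat.{u} R)) : Prop :=
  (∀ M, M ∈ 𝒜 ↔ ∀ B ∈ ℬ, ExtZero M B 1) ∧
  (∀ M, M ∈ ℬ ↔ ∀ A ∈ 𝒜, ExtZero A M 1)

/-- completeness of a cotorsion pair -/
def IsComplete (𝒜 ℬ : Set (ModuleCat.{u} R)) : Prop :=
  ∀ M : ModuleCat.{u} R,
    (∃ (B A : ModuleCat.{u} R) (f : B ⟶ A) (g : A ⟶ M), B ∈ ℬ ∧ A ∈ 𝒜 ∧ IsSES f g) ∧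
    (∃ (B A : ModuleCat.{u} R) (f : M ⟶ B) (g : B ⟶ A), B ∈ ℬ ∧ A ∈ 𝒜 ∧ IsSES f g)

/-- heredity of a cotorsion pair -/
def IsHereditary (𝒜 ℬ : Set (ModuleCat.{u} R)) : Prop :=
  ∀ i : ℕ, 1 ≤ i → ∀ A ∈ 𝒜, ∀ B ∈ ℬ, ExtZero A B i

variable (R)

/-- `𝒫`, the class of modules of finite projective dimension. -/
def P : Set (ModuleCat.{u} R) := {M | pd M < ⊤}

variable {R}

/-- `M` admits a projective resolution consisting of finitely generated projectives,
i.e. `M ∈ mod R`. -/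
def InmodR (M : ModuleCat.{u} R) : Prop :=
  ∃ K : ℕ → ModuleCat.{u} R, K 0 = M ∧ ∀ i : ℕ,
    ∃ (Q : ModuleCat.{u} R) (f : K (i+1) ⟶ Q) (g : Q ⟶ K i),
      Module.Finite R Q ∧ Projective Q ∧ IsSES f g

variable (R)

/-- `𝒫^{<∞} = 𝒫 ∩ mod R`. -/
def Pfin : Set (ModuleCat.{u} R) := {M | pd M < ⊤ ∧ InmodR M}

/-- the big finitistic dimension -/
def bigFindim : ℕ∞ := pdClass (P R)

/-- the little finitistic dimension -/
def littleFindim : ℕ∞ := pdClass (Pfin R)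

variable {R}

/-- `𝒳^{⊥₁}` -/
def rperp1 (𝒳 : Set (ModuleCat.{u} R)) : Set (ModuleCat.{u} R) :=
  {M | ∀ X ∈ 𝒳, ExtZero X M 1}

/-- `^{⊥₁}𝒳` -/
def lperp1 (𝒳 : Set (ModuleCat.{u} R)) : Set (ModuleCat.{u} R) :=
  {M | ∀ X ∈ 𝒳, ExtZero M X 1}

/-- `T^⊥ = {M : Ext^i(T,M) = 0 for all i > 0}` -/
def rperpAll (T : ModuleCat.{u} R) : Set (ModuleCat.{u} R) :=
  {M | ∀ i : ℕ, 0 < i → ExtZero T M i}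

/-- `Add T`: direct summands of arbitrary direct sums of copies of `T`. -/
def AddT (T : ModuleCat.{u} R) : Set (ModuleCat.{u} R) :=
  {M | ∃ (I : Type u) (s : M ⟶ ModuleCat.of R (I →₀ T)) (r : ModuleCat.of R (I →₀ T) ⟶ M),
    s ≫ r = 𝟙 M}

/-- `T` is a tilting module. -/
def IsTilting (T : ModuleCat.{u} R) : Prop :=
  pd T < ⊤ ∧
  (∀ i : ℕ, 0 < i → ∀ I : Type u, ExtZero T (ModuleCat.of R (I →₀ T)) i) ∧
  ∃ n, HasCoresLen (AddT T) n (ModuleCat.of R R)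


/-- `𝒳` is closed under arbitrary direct sums (coproducts). -/
def ClosedUnderCoproducts (𝒳 : Set (ModuleCat.{u} R)) : Prop :=
  ∀ (I : Type u) (f : I → ModuleCat.{u} R), (∀ i, f i ∈ 𝒳) →
    ModuleCat.of R (⨁ i, (f i : Type u)) ∈ 𝒳

/-- `𝒳` is closed under direct summands. -/
def ClosedUnderSummands (𝒳 : Set (ModuleCat.{u} R)) : Prop :=
  ∀ (M N : ModuleCat.{u} R) (s : M ⟶ N) (r : N ⟶ M), s ≫ r = 𝟙 M → N ∈ 𝒳 → M ∈ 𝒳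

theorem extZero_succ_iff (M N : ModuleCat.{u} R) (n : ℕ) :
    ExtZero M N (n + 1) ↔ Subsingleton (Abelian.Ext.{u} M N (n + 1)) := by
  let P := projectiveResolution M
  rw [ExtZero, (P.isoExt (R := ℤ) (n + 1) N).isZero_iff,
    ← HomologicalComplex.exactAt_iff_isZero_homology,
    HomologicalComplex.exactAt_iff' _ n (n + 1) (n + 2) (by simp) (by simp),
    ShortComplex.moduleCat_exact_iff]
  constructor
  · intro h
    refine subsingleton_of_forall_eq 0 fun α ↦ ?_
    obtain ⟨f, hf, rfl⟩ := P.extMk_surjective α (n + 2) rfl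
    exact (P.extMk_eq_zero_iff f (n + 2) rfl hf n rfl).2 (h f hf)
  · intro h f hf
    exact (P.extMk_eq_zero_iff f (n + 2) rfl hf n rfl).1 (Subsingleton.elim _ _)

theorem IsSES.extZero_right {X Y Z : ModuleCat.{u} R} {f : X ⟶ Y} {g : Y ⟶ Z} (h : IsSES f g)
    {M : ModuleCat.{u} R} {j : ℕ} (hY : ExtZero M Y (j + 1)) (hX : ExtZero M X (j + 2)) :
    ExtZero M Z (j + 1) := by
  obtain ⟨w, h⟩ := h
  rw [extZero_succ_iff] at *
  refine subsingleton_of_forall_eq 0 fun α ↦ ?_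
  obtain ⟨β, rfl⟩ := Abelian.Ext.covariant_sequence_exact₃ M h α rfl (Subsingleton.elim _ _)
  rw [Subsingleton.elim β 0, Abelian.Ext.zero_comp]

theorem IsSES.extZero_left {X Y Z : ModuleCat.{u} R} {f : X ⟶ Y} {g : Y ⟶ Z} (h : IsSES f g)
    {M : ModuleCat.{u} R} {j : ℕ} (hY : ExtZero M Y (j + 2)) (hZ : ExtZero M Z (j + 1)) :
    ExtZero M X (j + 2) := by
  obtain ⟨w, h⟩ := h
  rw [extZero_succ_iff] at *
  refine subsingleton_of_forall_eq 0 fun α ↦ ?_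
  obtain ⟨β, rfl⟩ := Abelian.Ext.covariant_sequence_exact₁ M h α (Subsingleton.elim _ _) rfl
  rw [Subsingleton.elim β 0, Abelian.Ext.zero_comp]

theorem IsSES.extZero_mid {X Y Z : ModuleCat.{u} R} {f : X ⟶ Y} {g : Y ⟶ Z} (h : IsSES f g)
    {N : ModuleCat.{u} R} {j : ℕ} (hX : ExtZero X N (j + 1)) (hZ : ExtZero Z N (j + 1)) :
    ExtZero Y N (j + 1) := by
  obtain ⟨w, h⟩ := h
  rw [extZero_succ_iff] at *
  refine subsingleton_of_forall_eq 0 fun α ↦ ?_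
  obtain ⟨β, rfl⟩ := Abelian.Ext.contravariant_sequence_exact₂ h N α (Subsingleton.elim _ _)
  rw [Subsingleton.elim β 0, Abelian.Ext.comp_zero]

theorem rpd_le_natCast_iff (𝒳 : Set (ModuleCat.{u} R)) (M : ModuleCat.{u} R) (n : ℕ) :
    rpd 𝒳 M ≤ n ↔ ∀ j : ℕ, n < j → ∀ X ∈ 𝒳, ExtZero M X j := by
  constructor
  · intro h j hj
    have hne : {n : ℕ∞ | ∀ j : ℕ, n < (j : ℕ∞) → ∀ X ∈ 𝒳, ExtZero M X j}.Nonempty :=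
      ⟨⊤, fun j hj ↦ absurd hj not_top_lt⟩
    exact csInf_mem hne j (h.trans_lt (by exact_mod_cast hj))
  · exact fun h ↦ sInf_le fun j hj ↦ h j (by exact_mod_cast hj)

theorem rpdClass_le_natCast_iff (𝒳 𝒴 : Set (ModuleCat.{u} R)) (n : ℕ) :
    rpdClass 𝒳 𝒴 ≤ n ↔ ∀ Y ∈ 𝒴, ∀ j : ℕ, n < j → ∀ X ∈ 𝒳, ExtZero Y X j := by
  simp only [rpdClass, iSup_le_iff, rpd_le_natCast_iff, Subtype.forall]

theorem coresdim_le_natCast_iff (𝒳 : Set (ModuleCat.{u} R)) (M : ModuleCat.{u} R) (n : ℕ) :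
    coresdim 𝒳 M ≤ n ↔ ∃ k ≤ n, HasCoresLen 𝒳 k M := by
  constructor
  · intro h
    rcases isEmpty_or_nonempty {n : ℕ // HasCoresLen 𝒳 n M} with he | hne
    · simp [coresdim] at h
    · obtain ⟨⟨k, hk⟩, hk'⟩ :=
        csInf_mem (Set.range_nonempty fun n : {n : ℕ // HasCoresLen 𝒳 n M} ↦ (n : ℕ∞))
      refine ⟨k, ?_, hk⟩
      have : (k : ℕ∞) ≤ n := hk'.trans_le h
      exact_mod_cast this
  · rintro ⟨k, hkn, hk⟩
    exact (iInf_le _ ⟨k, hk⟩).trans (by exact_mod_cast hkn)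

theorem coresdimClass_le_natCast_iff (𝒳 𝒴 : Set (ModuleCat.{u} R)) (n : ℕ) :
    coresdimClass 𝒳 𝒴 ≤ n ↔ ∀ Y ∈ 𝒴, ∃ k ≤ n, HasCoresLen 𝒳 k Y := by
  simp only [coresdimClass, iSup_le_iff, coresdim_le_natCast_iff, Subtype.forall]

theorem HasCoresLen.mono {𝒳 𝒴 : Set (ModuleCat.{u} R)} (h : 𝒳 ⊆ 𝒴) {n : ℕ}
    {M : ModuleCat.{u} R} (hM : HasCoresLen 𝒳 n M) : HasCoresLen 𝒴 n M := by
  induction n generalizing M with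
  | zero => exact h hM
  | succ n ih =>
    obtain ⟨X, C, f, g, hX, hfg, hC⟩ := hM
    exact ⟨X, C, f, g, h hX, hfg, ih hC⟩

theorem HasCoresLen.extZero {𝒜 ℬ : Set (ModuleCat.{u} R)} (hher : IsHereditary 𝒜 ℬ) {n : ℕ}
    {M : ModuleCat.{u} R} (hM : HasCoresLen ℬ n M) {A : ModuleCat.{u} R} (hA : A ∈ 𝒜) {j : ℕ}
    (hj : n < j) : ExtZero A M j := by
  induction n generalizing M j with
  | zero => exact hher j hj A hA M hM
  | succ n ih =>
    obtain ⟨X, C, f, g, hX, hfg, hC⟩ := hM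
    obtain ⟨i, rfl⟩ := Nat.exists_eq_add_of_le' (show 2 ≤ j by lia)
    exact hfg.extZero_left (hher _ (by lia) A hA X hX) (ih hC (by lia))

theorem hasCoresLen_of_extZero {𝒜 ℬ : Set (ModuleCat.{u} R)} (hcp : IsCotorsionPair 𝒜 ℬ)
    (hcomp : IsComplete 𝒜 ℬ) (hher : IsHereditary 𝒜 ℬ) {n : ℕ} {M : ModuleCat.{u} R}
    (hM : ∀ A ∈ 𝒜, ExtZero A M (n + 1)) : HasCoresLen ℬ n M := by
  induction n generalizing M with
  | zero => exact (hcp.2 M).2 hM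
  | succ n ih =>
    obtain ⟨B, C, f, g, hB, hC, hfg⟩ := (hcomp M).2
    exact ⟨B, C, f, g, hB, hfg, ih fun A hA ↦
      hfg.extZero_right (hher _ (by lia) A hA B hB) (hM A hA)⟩

theorem hasCoresLen_inter_of_extZero {𝒜 ℬ : Set (ModuleCat.{u} R)} (hcp : IsCotorsionPair 𝒜 ℬ)
    (hcomp : IsComplete 𝒜 ℬ) (hher : IsHereditary 𝒜 ℬ) {n : ℕ} {M : ModuleCat.{u} R}
    (hMA : M ∈ 𝒜) (hM : ∀ A ∈ 𝒜, ExtZero A M (n + 1)) : HasCoresLen (𝒜 ∩ ℬ) n M := by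
  induction n generalizing M with
  | zero => exact ⟨hMA, (hcp.2 M).2 hM⟩
  | succ n ih =>
    obtain ⟨B, C, f, g, hB, hC, hfg⟩ := (hcomp M).2
    have hBA : B ∈ 𝒜 := (hcp.1 B).2 fun N hN ↦
      hfg.extZero_mid ((hcp.1 M).1 hMA N hN) ((hcp.1 C).1 hC N hN)
    exact ⟨B, C, f, g, ⟨hBA, hB⟩, hfg, ih hC fun A hA ↦
      hfg.extZero_right (hher _ (by lia) A hA B hB) (hM A hA)⟩

theorem eq_of_forall_le_natCast_iff {a b : ℕ∞} (h : ∀ n : ℕ, a ≤ n ↔ b ≤ n) : a = b := by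
  apply le_antisymm
  · induction b using ENat.recTopCoe with
    | top => exact le_top
    | coe n => exact (h n).2 le_rfl
  · induction a using ENat.recTopCoe with
    | top => exact le_top
    | coe n => exact (h n).1 le_rfl

/-- Theorem 2.5(a): for a hereditary complete cotorsion pair with kernel `ω`,
`pd 𝒜 = pd_𝒜(𝒜) = coresdim_ℬ(𝒜) = coresdim_ω(𝒜) = coresdim_ℬ(Mod R)`. -/
theorem stmt7 {R : Type u} [Ring R] (𝒜 ℬ ω : Set (ModuleCat.{u} R))
    (hcp : IsCotorsionPair 𝒜 ℬ) (hcomp : IsComplete 𝒜 ℬ) (hher : IsHereditary 𝒜 ℬ)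
    (hω : ω = 𝒜 ∩ ℬ) :
    pdClass 𝒜 = rpdClass 𝒜 𝒜 ∧
    rpdClass 𝒜 𝒜 = coresdimClass ℬ 𝒜 ∧
    coresdimClass ℬ 𝒜 = coresdimClass ω 𝒜 ∧
    coresdimClass ω 𝒜 = coresdimClass ℬ Set.univ := by
  subst hω
  have tfae (n : ℕ) : List.TFAE [pdClass 𝒜 ≤ n, rpdClass 𝒜 𝒜 ≤ n, coresdimClass ℬ 𝒜 ≤ n,
      coresdimClass (𝒜 ∩ ℬ) 𝒜 ≤ n, coresdimClass ℬ Set.univ ≤ n] := by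
    have hpd : pdClass 𝒜 = rpdClass Set.univ 𝒜 := rfl
    simp only [hpd, rpdClass_le_natCast_iff, coresdimClass_le_natCast_iff]
    tfae_have 1 → 5 := fun h M _ ↦ ⟨n, le_rfl, hasCoresLen_of_extZero hcp hcomp hher
      fun A hA ↦ h A hA _ n.lt_succ_self M trivial⟩
    tfae_have 5 → 3 := fun h M _ ↦ h M trivial
    tfae_have 3 → 2 := fun h A hA j hj M hM ↦
      let ⟨_, hkn, hk⟩ := h M hM
      hk.extZero hher hA (hkn.trans_lt hj)
    tfae_have 2 → 4 := fun h M hM ↦ ⟨n, le_rfl, hasCoresLen_inter_of_extZero hcp hcomp hher hM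
      fun A hA ↦ h A hA _ n.lt_succ_self M hM⟩
    tfae_have 4 → 3 := fun h M hM ↦
      let ⟨k, hkn, hk⟩ := h M hM
      ⟨k, hkn, hk.mono Set.inter_subset_right⟩
    tfae_have 2 → 1 := by
      intro h A hA j hj M _
      obtain ⟨B, C, f, g, hB, hC, hfg⟩ := (hcomp M).1
      obtain ⟨i, rfl⟩ := Nat.exists_eq_add_of_le' (show 1 ≤ j by lia)
      exact hfg.extZero_right (h A hA _ hj C hC) (hher _ (by lia) A hA B hB)
    tfae_finish
  refine ⟨?_, ?_, ?_, ?_⟩ <;> refine eq_of_forall_le_natCast_iff fun n ↦ ?_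
  exacts [(tfae n).out 0 1, (tfae n).out 1 2, (tfae n).out 2 3, (tfae n).out 3 4]

end CotorsionDim
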